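/- Let a and b be countable closed subsets of the Baire space ω^ω, and let U be a nonempty open subset of ω^ω with a ⊆ U. Then there is a self-homeomorphism h of ω^ω such that h x = x for all x ∈ a and h '' b ⊆ U. -/

import Mathlib

open PiNat in
/-- In the Baire space, disjoint closed sets can be separated by a clopen set. -/
theorem exists_isClopen_between {s u : Set (ℕ → ℕ)} (hs : IsClosed s) (hu : IsOpen u)
    (hne : s.Nonempty) (hsu : s ⊆ u) : ∃ v, IsClopen v ∧ s ⊆ v ∧ v ⊆ u := by
  have hS : IsClosed (s ∪ uᶜ) := hs.union hu.isClosed_compl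
  obtain ⟨f, hf, hrange, hfc⟩ :=
    exists_retraction_of_isClosed hS (hne.mono Set.subset_union_left)
  have hmem : ∀ x, f x ∈ s ∪ uᶜ := fun x ↦ hrange ▸ Set.mem_range_self x
  have hcompl : f ⁻¹' s = (f ⁻¹' uᶜ)ᶜ := by
    ext x
    have := hmem x
    have := @hsu (f x)
    simp only [Set.mem_preimage, Set.mem_compl_iff, Set.mem_union] at *
    tauto
  refine ⟨f ⁻¹' s, ⟨hs.preimage hfc, ?_⟩, fun x hx ↦ ?_, fun x hx ↦ ?_⟩
  · rw [hcompl]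
    exact (hu.isClosed_compl.preimage hfc).isOpen_compl
  · rwa [Set.mem_preimage, hf x (Or.inl hx)]
  · by_contra hxu
    have h := hf x (Or.inr hxu)
    rw [Set.mem_preimage, h] at hx
    exact hxu (hsu hx)

/-- A clopen set `w` and a disjoint clopen copy `c` of it, identified by mutually inverse
continuous maps, are exchanged by a self-homeomorphism that is the identity elsewhere. -/
theorem exists_homeomorph_swap {X : Type*} [TopologicalSpace X] {w c : Set X}
    (hw : IsClopen w) (hc : IsClopen c) (hwc : Disjoint w c) {f g : X → X}
    (hf : Continuous f) (hg : Continuous g) (hfc : Set.MapsTo f w c) (hgw : Set.MapsTo g c w)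
    (hgf : Set.LeftInvOn g f w) (hfg : Set.LeftInvOn f g c) :
    ∃ h : X ≃ₜ X, Set.MapsTo h w c ∧ ∀ x, x ∉ w → x ∉ c → h x = x := by
  classical
  let k : X → X := fun x ↦ if x ∈ w then f x else if x ∈ c then g x else x
  have hk : Continuous k := by
    refine hf.if (fun x hx ↦ ?_) (hg.if (fun x hx ↦ ?_) continuous_id)
    · have := hw.frontier_eq
      simp_all
    · have := hc.frontier_eq
      simp_all
  have hcw : ∀ x ∈ c, x ∉ w := fun x hx hx' ↦ Set.disjoint_left.1 hwc hx' hx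
  have hinv : Function.Involutive k := by
    intro x
    by_cases hxw : x ∈ w
    · simp [k, hxw, hcw _ (hfc hxw), hfc hxw, hgf hxw]
    · by_cases hxc : x ∈ c
      · simp [k, hxw, hxc, hgw hxc, hfg hxc]
      · simp [k, hxw, hxc]
  refine ⟨⟨hinv.toPerm k, hk, hk⟩, fun x hx ↦ ?_, fun x hxw hxc ↦ ?_⟩
  · change k x ∈ c
    simpa [k, hx] using hfc hx
  · change k x = x
    simp [k, hxw, hxc]

/-- The sequence `x` preceded by the first `n` terms of `u`. -/
def prependPrefix (u : ℕ → ℕ) (n : ℕ) (x : ℕ → ℕ) : ℕ → ℕ :=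
  fun i ↦ if i < n then u i else x (i - n)

theorem continuous_prependPrefix (u : ℕ → ℕ) (n : ℕ) : Continuous (prependPrefix u n) := by
  refine continuous_pi fun i ↦ ?_
  unfold prependPrefix
  split_ifs <;> fun_prop

theorem prependPrefix_mem_cylinder (u : ℕ → ℕ) (n : ℕ) (x : ℕ → ℕ) :
    prependPrefix u n x ∈ PiNat.cylinder u n := fun i hi ↦ by
  simp [prependPrefix, hi]

theorem shift_prependPrefix (u : ℕ → ℕ) (n : ℕ) (x : ℕ → ℕ) :
    (fun i ↦ prependPrefix u n x (i + n)) = x := by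
  simp [prependPrefix]

theorem prependPrefix_shift {u : ℕ → ℕ} {n : ℕ} {x : ℕ → ℕ} (hx : x ∈ PiNat.cylinder u n) :
    prependPrefix u n (fun i ↦ x (i + n)) = x := by
  ext i
  unfold prependPrefix
  split_ifs with hi
  · exact (hx i hi).symm
  · simp [Nat.sub_add_cancel (not_lt.1 hi)]

theorem exists_cylinder_subset {v : Set (ℕ → ℕ)} (hv : IsOpen v) {x : ℕ → ℕ} (hx : x ∈ v) :
    ∃ n, PiNat.cylinder x n ⊆ v := by
  obtain ⟨_, ⟨y, n, rfl⟩, hxy, hsub⟩ :=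
    (PiNat.isTopologicalBasis_cylinders (fun _ : ℕ ↦ ℕ)).exists_subset_of_mem_open hx hv
  exact ⟨n, PiNat.mem_cylinder_iff_eq.1 hxy ▸ hsub⟩

theorem not_countable_of_isOpen_baire {v : Set (ℕ → ℕ)} (hv : IsOpen v) (hne : v.Nonempty) :
    ¬ v.Countable := by
  intro hcount
  obtain ⟨x, hx⟩ := hne
  obtain ⟨n, hn⟩ := exists_cylinder_subset hv hx
  have hinj : Function.Injective (prependPrefix x n) := fun y z hyz ↦ by
    rw [← shift_prependPrefix x n y, hyz, shift_prependPrefix]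
  have huniv : (Set.univ : Set (ℕ → ℕ)).Countable :=
    (hcount.preimage hinj).mono fun y _ ↦ Set.mem_preimage.2 <|
      hn (prependPrefix_mem_cylinder x n y)
  have : Uncountable (ℕ → ℕ) := by
    rw [← Cardinal.aleph0_lt_mk_iff]
    simp [Cardinal.aleph0_lt_continuum]
  exact Set.not_countable_univ huniv

/-- Tightness of the Baire space with the ideal of countable
closed sets. -/
theorem stmt4 (a b : Set (ℕ → ℕ))
    (ha : a.Countable) (haC : IsClosed a)
    (hb : b.Countable) (hbC : IsClosed b)
    (U : Set (ℕ → ℕ)) (hU : IsOpen U) (hUne : U.Nonempty) (haU : a ⊆ U) :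
    ∃ h : (ℕ → ℕ) ≃ₜ (ℕ → ℕ), (∀ x ∈ a, h x = x) ∧ h '' b ⊆ U := by
  obtain ⟨u, hu⟩ := hUne
  obtain ⟨v, hv, hav, hvU⟩ := exists_isClopen_between (isClosed_singleton.union haC) hU
    ⟨u, Or.inl rfl⟩ (Set.union_subset (Set.singleton_subset_iff.2 hu) haU)
  obtain ⟨p, hpv, hpab⟩ : ∃ p ∈ v, p ∉ a ∪ b := Set.not_subset.1 fun hsub ↦
    not_countable_of_isOpen_baire hv.isOpen ⟨u, hav (Or.inl rfl)⟩ ((ha.union hb).mono hsub)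
  obtain ⟨n, hn⟩ := exists_cylinder_subset
    (hv.isOpen.inter (haC.union hbC).isOpen_compl) ⟨hpv, hpab⟩
  have hshift : Continuous fun (x : ℕ → ℕ) i ↦ x (i + n) := by fun_prop
  have hcyl : IsClopen (PiNat.cylinder p n) := by
    refine ⟨?_, PiNat.isOpen_cylinder _ p n⟩
    simp only [PiNat.cylinder, Set.ofPred_forall]
    exact isClosed_iInter fun i ↦ isClosed_iInter fun _ ↦
      isClosed_eq (continuous_apply i) continuous_const
  obtain ⟨h, hmaps, hfix⟩ := exists_homeomorph_swap hv.compl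
    (hcyl.inter (hv.compl.preimage hshift))
    (Set.disjoint_left.2 fun x hx hxc ↦ hx (hn hxc.1).1)
    (continuous_prependPrefix p n) hshift
    (fun x hx ↦ ⟨prependPrefix_mem_cylinder p n x, by
      rwa [Set.mem_preimage, shift_prependPrefix]⟩)
    (fun x hx ↦ hx.2) (fun x _ ↦ shift_prependPrefix p n x)
    (fun x hx ↦ prependPrefix_shift hx.1)
  refine ⟨h, fun x hx ↦ hfix x (fun hxv ↦ hxv (hav (Or.inr hx)))
    fun hxc ↦ (hn hxc.1).2 (Or.inl hx), ?_⟩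
  rintro _ ⟨x, hx, rfl⟩
  by_cases hxv : x ∈ v
  · rw [hfix x (fun hxv' ↦ hxv' hxv) fun hxc ↦ (hn hxc.1).2 (Or.inr hx)]
    exact hvU hxv
  · exact hvU (hn (hmaps hxv).1).1
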